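/- Let b ∈ GL_n(R) with b − b^{-1} ∈ GL_n(R), q symmetric with ᵗb q b = q, and p = q(b − b^{-1}). Then the centralizer of b in O(q,R) equals the centralizer of b in Sp(p,R), and both equal the centralizer of b in SO(q,R). -/

import Mathlib

open Matrix

namespace Polynomial

/-- A linear polynomial with commuting coefficients that generate the unit left ideal is left
regular. -/
theorem eq_zero_of_linear_mul_eq_zero {S : Type*} [Ring S] {A B V W : S} (hAB : Commute A B)
    (h : V * A + W * B = 1) {Q : S[X]} (hQ : (X * C A + C B) * Q = 0) : Q = 0 := by
  suffices ∀ (N : ℕ) (Q : S[X]), Q.degree < N → (X * C A + C B) * Q = 0 → Q = 0 from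
    this (Q.natDegree + 1) Q (degree_le_natDegree.trans_lt (by exact_mod_cast Nat.lt_succ_self _))
      hQ
  intro N
  induction N with
  | zero => exact fun Q hdeg _ => degree_eq_bot.1 (by simpa using hdeg)
  | succ N ih =>
    intro Q hdeg hQ
    have htop : Q.coeff (N + 1) = 0 := coeff_eq_zero_of_degree_lt hdeg
    have hlead : A * Q.coeff N = 0 := by
      have := congrArg (coeff · (N + 1)) hQ
      simpa [add_mul, mul_assoc, htop] using this
    have hcomm : (X * C A + C B) * C A = C A * (X * C A + C B) := by
      rw [add_mul, mul_add, ← C_mul, ← C_mul, hAB.eq, ← mul_assoc, X_mul_C]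
    have hA : C A * Q = 0 := by
      refine ih _ ?_ (by rw [← mul_assoc, hcomm, mul_assoc, hQ, mul_zero])
      rw [degree_lt_iff_coeff_zero]
      intro k hk
      rw [coeff_C_mul]
      rcases hk.eq_or_lt with rfl | hk
      · exact hlead
      · rw [coeff_eq_zero_of_degree_lt (hdeg.trans_le (by exact_mod_cast hk)), mul_zero]
    have hB : C B * Q = 0 := by
      rwa [add_mul, mul_assoc, hA, mul_zero, zero_add] at hQ
    calc Q = C (V * A + W * B) * Q := by simp [h]
      _ = C V * (C A * Q) + C W * (C B * Q) := by simp [add_mul, mul_assoc]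
      _ = 0 := by simp [hA, hB]

end Polynomial

namespace Matrix

open Polynomial

variable {n : Type*} [Fintype n] [DecidableEq n]

theorem det_linear_pencil_ne_zero {K : Type*} [Field K] {A B V W : Matrix n n K}
    (hAB : Commute A B) (h : V * A + W * B = 1) :
    det ((X : K[X]) • A.map C + B.map C) ≠ 0 := by
  intro hdet
  obtain ⟨v, hv, hv0⟩ := exists_mulVec_eq_zero_iff.2 hdet
  have hM : ((X : K[X]) • A.map C + B.map C) * vecMulVec v v = 0 := by
    rw [mul_vecMulVec, hv0, zero_vecMulVec]
  have hpencil : matPolyEquiv ((X : K[X]) • A.map C + B.map C) = X * C A + C B := by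
    simp
  have hzero : matPolyEquiv (vecMulVec v v) = 0 :=
    eq_zero_of_linear_mul_eq_zero hAB h (by rw [← hpencil, ← map_mul, hM, map_zero])
  rw [EmbeddingLike.map_eq_zero_iff] at hzero
  refine hv (funext fun i => ?_)
  simpa [vecMulVec_apply] using congrFun (congrFun hzero i) i

/-- No nonzero scalar annihilates the determinant of a linear pencil with commuting coefficients
that generate the unit left ideal. -/
theorem eq_zero_of_C_mul_det_linear_pencil_eq_zero {R : Type*} [CommRing R]
    {A B V W : Matrix n n R} (hAB : Commute A B) (h : V * A + W * B = 1) {r : R}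
    (hr : C r * det ((X : R[X]) • A.map C + B.map C) = 0) : r = 0 := by
  by_contra hne
  have hspan : Ideal.span {r} ≠ ⊥ := by simpa using hne
  have hann : (Ideal.span {r}).annihilator ≠ ⊤ := by
    rwa [Ne, Submodule.annihilator_eq_top_iff]
  obtain ⟨m, hm, hle⟩ := Ideal.exists_le_maximal _ hann
  let := Ideal.Quotient.field m
  let φ := Ideal.Quotient.mk m
  have hAB' : Commute (φ.mapMatrix A) (φ.mapMatrix B) := hAB.map φ.mapMatrix
  have h' : φ.mapMatrix V * φ.mapMatrix A + φ.mapMatrix W * φ.mapMatrix B = 1 := by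
    rw [← map_mul, ← map_mul, ← map_add, h, map_one]
  refine det_linear_pencil_ne_zero hAB' h' ?_
  have hmap : (X : (R ⧸ m)[X]) • (φ.mapMatrix A).map C + (φ.mapMatrix B).map C =
      (mapRingHom φ).mapMatrix ((X : R[X]) • A.map C + B.map C) := by
    ext1 i j
    simp
  rw [hmap, ← RingHom.map_det]
  ext k
  rw [coe_mapRingHom, coeff_map, coeff_zero, Ideal.Quotient.eq_zero_iff_mem]
  apply hle
  rw [Submodule.mem_annihilator_span_singleton, smul_eq_mul, mul_comm, ← coeff_C_mul, hr,
    coeff_zero]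

/-- An isometry of `q` commuting with an isometry `b` such that `b - b⁻¹` is invertible has
determinant one. -/
theorem det_eq_one_of_commute_isometry {R : Type*} [CommRing R] {b q x : Matrix n n R}
    (hb : IsUnit b) (hbb : IsUnit (b - b⁻¹)) (hq : IsUnit q) (hbq : bᵀ * q * b = q)
    (hxb : x * b = b * x) (hxq : xᵀ * q * x = q) : x.det = 1 := by
  have hdet : IsUnit b.det := (isUnit_iff_isUnit_det b).1 hb
  obtain ⟨c, hc⟩ : ∃ c, c = b⁻¹ := ⟨_, rfl⟩
  have hbc : b * c = 1 := hc ▸ mul_nonsing_inv b hdet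
  have hcb : c * b = 1 := hc ▸ nonsing_inv_mul b hdet
  rw [← hc] at hbb
  have hxc : x * c = c * x := by
    calc x * c = c * (b * x) * c := by rw [← mul_assoc, hcb, one_mul]
      _ = c * x := by rw [← hxb, mul_assoc, mul_assoc, hbc, mul_one]
  have hbq' : bᵀ * q = q * c := by
    calc bᵀ * q = bᵀ * q * b * c := by rw [mul_assoc, hbc, mul_one]
      _ = q * c := by rw [hbq]
  have hcq : cᵀ * q = q * b := by
    calc cᵀ * q = cᵀ * (bᵀ * q * b) := by rw [hbq]
      _ = (b * c)ᵀ * (q * b) := by simp only [transpose_mul, mul_assoc]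
      _ = q * b := by rw [hbc, transpose_one, one_mul]
  -- The adjoint of `y = X (1 + x) + (b + x b⁻¹)` with respect to `q` is `x⁻¹ y`.
  have hA : xᵀ * q * (1 + x) = (1 + x)ᵀ * q := by
    rw [mul_add, hxq, mul_one, transpose_add, transpose_one, add_mul, one_mul, add_comm]
  have hB : xᵀ * q * (b + x * c) = (b + x * c)ᵀ * q := by
    rw [mul_add, ← mul_assoc, hxq, transpose_add, add_mul, hbq', hxc, transpose_mul,
      mul_assoc xᵀ cᵀ, hcq, add_comm, mul_assoc]
  set y : Matrix n n R[X] := (X : R[X]) • (1 + x).map C + (b + x * c).map C with hy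
  have hadj : (xᵀ * q).map C * y = yᵀ * q.map C := by
    rw [hy, mul_add, mul_smul_comm, ← Matrix.map_mul, ← Matrix.map_mul, hA, hB,
      transpose_add (X • _), transpose_smul, add_mul, smul_mul_assoc,
      ← transpose_map, ← transpose_map, Matrix.map_mul,
      Matrix.map_mul]
  have hdety : C (q.det * (x.det - 1)) * y.det = 0 := by
    have := congrArg det hadj
    rw [det_mul, det_mul, det_transpose, ← RingHom.mapMatrix_apply, ← RingHom.mapMatrix_apply,
      ← RingHom.map_det, ← RingHom.map_det, det_mul, det_transpose] at this
    simp only [map_mul, map_sub, map_one] at this ⊢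
    linear_combination this
  obtain ⟨w, hw⟩ := hbb.exists_left_inv
  have hcomm : Commute (1 + x) (b + x * c) :=
    (Commute.one_left _).add_left
      (Commute.add_right hxb ((Commute.refl x).mul_right hxc))
  have hgen : -(w * c) * (1 + x) + w * (b + x * c) = 1 := by
    refine Eq.trans ?_ hw
    rw [hxc]
    noncomm_ring
  have hzero := eq_zero_of_C_mul_det_linear_pencil_eq_zero hcomm hgen hdety
  rw [((isUnit_iff_isUnit_det q).1 hq).mul_right_eq_zero] at hzero
  exact sub_eq_zero.1 hzero

end Matrix

/-- For `b` with `b − b⁻¹` invertible, `q` symmetric invertible with `ᵗb q b = q` and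
`p = q (b − b⁻¹)`, the centralizer of `b` in `O(q,R)` equals the centralizer of `b` in
`Sp(p,R)`, and both equal the centralizer of `b` in `SO(q,R)`. -/
theorem centralizers_coincide {R : Type*} [CommRing R] [Invertible (2 : R)] {n : ℕ}
    (b : Matrix (Fin n) (Fin n) R) (hb : IsUnit b) (hbb : IsUnit (b - b⁻¹))
    (q : Matrix (Fin n) (Fin n) R) (hsymm : qᵀ = q) (hq : IsUnit q)
    (hbq : bᵀ * q * b = q) :
    {x : Matrix (Fin n) (Fin n) R | IsUnit x ∧ x * b = b * x ∧ xᵀ * q * x = q} =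
      {x : Matrix (Fin n) (Fin n) R | IsUnit x ∧ x * b = b * x ∧
        xᵀ * (q * (b - b⁻¹)) * x = q * (b - b⁻¹)} ∧
    {x : Matrix (Fin n) (Fin n) R | IsUnit x ∧ x * b = b * x ∧ xᵀ * q * x = q} =
      {x : Matrix (Fin n) (Fin n) R | IsUnit x ∧ x * b = b * x ∧ xᵀ * q * x = q ∧
        x.det = 1} := by
  have hdet : IsUnit b.det := (isUnit_iff_isUnit_det b).1 hb
  refine ⟨Set.ext fun x => and_congr_right fun _ => and_congr_right fun hxb => ?_,
    Set.ext fun x => and_congr_right fun _ => and_congr_right fun hxb => ?_⟩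
  · have hxinv : x * b⁻¹ = b⁻¹ * x := by
      calc x * b⁻¹ = b⁻¹ * (b * x) * b⁻¹ := by
            rw [← mul_assoc, nonsing_inv_mul b hdet, one_mul]
        _ = b⁻¹ * x := by
            rw [← hxb, mul_assoc, mul_assoc, mul_nonsing_inv b hdet, mul_one]
    have hmove : xᵀ * (q * (b - b⁻¹)) * x = xᵀ * q * x * (b - b⁻¹) := by
      simp only [mul_assoc, mul_sub, sub_mul, hxb, hxinv]
    rw [hmove, hbb.mul_left_inj]
  · exact ⟨fun hxq => ⟨hxq, det_eq_one_of_commute_isometry hb hbb hq hbq hxb hxq⟩, And.left⟩
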